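/- Let a, b, c, t, C, C' be real numbers with a ≥ b ≥ c > 0, t > 1, C > 0, C' > 0, and suppose cosh C = (cosh c + cosh a·cosh b)/(sinh a·sinh b) and cosh C' = (cosh(tc) + cosh(ta)·cosh(tb))/(sinh(ta)·sinh(tb)). Then C' < C; in particular C' ≠ t·C. -/

import Mathlib

open Real

lemma hex_aux (b c t : ℝ) (hbc : c ≤ b) (hc : 0 < c) (ht : 1 < t) :
    cosh (t * c) / sinh (t * b) < cosh c / sinh b := by
  have hb : 0 < b := by linarith
  have htb : 0 < t * b := by positivity
  rw [div_lt_div_iff₀ (sinh_pos_iff.2 htb) (sinh_pos_iff.2 hb)]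
  have h1 : sinh (b + t * c) ≤ sinh (t * b + c) := sinh_le_sinh.2 (by nlinarith)
  have h2 : sinh (b - t * c) < sinh (t * b - c) := sinh_lt_sinh.2 (by nlinarith)
  rw [sinh_add, sinh_add] at h1
  rw [sinh_sub, sinh_sub] at h2
  nlinarith

theorem hexagon_scaling_contracts (a b c t C C' : ℝ)
    (hab : a ≥ b) (hbc : b ≥ c) (hc : c > 0) (ht : t > 1)
    (hC : C > 0) (hC' : C' > 0)
    (hCosh : cosh C = (cosh c + cosh a * cosh b) / (sinh a * sinh b))
    (hCosh' : cosh C' = (cosh (t * c) + cosh (t * a) * cosh (t * b)) / (sinh (t * a) * sinh (t * b))) :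
    C' < C ∧ C' ≠ t * C := by
  have hb : 0 < b := by linarith
  have ha : 0 < a := by linarith
  have sa := sinh_pos_iff.2 ha
  have sb := sinh_pos_iff.2 hb
  have sta : 0 < sinh (t * a) := sinh_pos_iff.2 (by positivity)
  have stb : 0 < sinh (t * b) := sinh_pos_iff.2 (by positivity)
  have h1 := hex_aux b c t hbc hc ht
  have h2 := hex_aux a a t le_rfl ha ht
  have h3 := hex_aux b b t le_rfl hb ht
  have h4 : 1 / sinh (t * a) < 1 / sinh a :=
    one_div_lt_one_div_of_lt sa (sinh_lt_sinh.2 (by nlinarith))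
  have p1 : cosh (t * c) / sinh (t * b) * (1 / sinh (t * a)) < cosh c / sinh b * (1 / sinh a) :=
    mul_lt_mul'' h1 h4 (div_pos (cosh_pos _) stb).le (by positivity)
  have p2 : cosh (t * a) / sinh (t * a) * (cosh (t * b) / sinh (t * b))
      < cosh a / sinh a * (cosh b / sinh b) :=
    mul_lt_mul'' h2 h3 (div_pos (cosh_pos _) sta).le (div_pos (cosh_pos _) stb).le
  have key : cosh C' < cosh C := by
    rw [hCosh, hCosh']
    calc _ = cosh (t * c) / sinh (t * b) * (1 / sinh (t * a))
          + cosh (t * a) / sinh (t * a) * (cosh (t * b) / sinh (t * b)) := by field_simp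
      _ < cosh c / sinh b * (1 / sinh a) + cosh a / sinh a * (cosh b / sinh b) := by linarith
      _ = _ := by field_simp
  have hlt : C' < C := by
    rwa [cosh_lt_cosh, abs_of_pos hC', abs_of_pos hC] at key
  exact ⟨hlt, by nlinarith [mul_pos (sub_pos.2 ht) hC] |> fun (h : C' < t * C) => h.ne⟩
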